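/- arXiv:1505.04436 — 3 statements merged into one kernel-verified Lean document; each statement's English description precedes it below -/
import Mathlib

section
/- Let $w_0, w_1, w_2$ be nonzero real numbers. Define, for a triple $(a_0,a_1,a_2) \in \mathbb{C}^3$ satisfying $a_i w_j \neq a_j w_i$ for all $0 \le i < j \le 2$, the quantity $F(a_0,a_1,a_2) = \sum_{i=0}^{2} \frac{1}{w_i^2} \cdot \frac{\big(\sum_{k \neq i} (a_k w_i - a_i w_k)\big)^3}{\prod_{k \neq i} (a_k w_i - a_i w_k)}$. Then there exists a multivariate polynomial $P \in \mathbb{C}[X_0, X_1, X_2]$, homogeneous of degree $4$, such that for every $(a_0,a_1,a_2) \in \mathbb{C}^3$ with $a_i w_j \neq a_j w_i$ for all $i \neq j$, one has $w_0^2 w_1^2 w_2^2 \cdot \prod_{0 \le i < j \le 2} (a_i w_j - a_j w_i) \cdot F(a_0,a_1,a_2) = P(a_0, a_1, a_2)$, and moreover the coefficient of the monomial $X_0^2 X_1 X_2$ in $P$ equals $-3 w_0 w_1^5 w_2^2 - 3 w_0 w_1^4 w_2^3 + 3 w_0 w_1^3 w_2^4 + 3 w_0 w_1^2 w_2^5 -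 3 w_0^4 w_1^2 w_2^2 + 3 w_0^3 w_1^2 w_2^3 + 6 w_0^2 w_1^2 w_2^4 + 3 w_0^4 w_1^2 w_2^2 - 3 w_0^3 w_1^3 w_2^2 - 6 w_0^2 w_1^4 w_2^2$. -/
open MvPolynomial in
/-- The linear form `p X₀ + q X₁ + r X₂`. -/
noncomputable def ternaryLinearForm (p q r : ℂ) : MvPolynomial (Fin 3) ℂ :=
  C p * X 0 + C q * X 1 + C r * X 2

open MvPolynomial in
theorem isHomogeneous_ternaryLinearForm (p q r : ℂ) :
    (ternaryLinearForm p q r).IsHomogeneous 1 :=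
  ((isHomogeneous_C_mul_X p 0).add (isHomogeneous_C_mul_X q 1)).add (isHomogeneous_C_mul_X r 2)

theorem eval_ternaryLinearForm (p q r x y z : ℂ) :
    MvPolynomial.eval ![x, y, z] (ternaryLinearForm p q r) = p * x + q * y + r * z := by
  simp [ternaryLinearForm]

open MvPolynomial in
theorem isHomogeneous_C_mul_linear_mul_cube (k a b c p q r : ℂ) :
    (C k * (ternaryLinearForm a b c * ternaryLinearForm p q r ^ 3)).IsHomogeneous 4 :=
  ((isHomogeneous_ternaryLinearForm a b c).mul
    ((isHomogeneous_ternaryLinearForm p q r).pow 3)).C_mul k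

open MvPolynomial in
theorem coeff_X_pow_mul_eq_zero {σ R : Type*} [CommSemiring R] {i : σ} {n : ℕ} {m : σ →₀ ℕ}
    (h : m i < n) (Q : MvPolynomial σ R) : coeff m (X i ^ n * Q) = 0 := by
  classical
  rw [X_pow_eq_monomial, coeff_monomial_mul', if_neg]
  intro hle
  have := hle i
  rw [Finsupp.single_eq_same] at this
  omega

open MvPolynomial in
/-- The only monomial of degree four divisible by none of `X₀³`, `X₁²`, `X₂²` is `X₀² X₁ X₂`,
so its coefficient can be read off modulo these three powers. -/
theorem coeff_linear_mul_cube (a b c p q r : ℂ) :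
    coeff (Finsupp.single (0 : Fin 3) 2 + Finsupp.single (1 : Fin 3) 1 +
        Finsupp.single (2 : Fin 3) 1)
      (ternaryLinearForm a b c * ternaryLinearForm p q r ^ 3) =
      6 * a * p * q * r + 3 * p ^ 2 * (b * r + c * q) := by
  have expand : ternaryLinearForm a b c * ternaryLinearForm p q r ^ 3 =
      monomial (Finsupp.single (0 : Fin 3) 2 + Finsupp.single (1 : Fin 3) 1 +
        Finsupp.single (2 : Fin 3) 1) (6 * a * p * q * r + 3 * p ^ 2 * (b * r + c * q)) +
      X 0 ^ 3 * (C p ^ 3 * ternaryLinearForm a b c +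
        3 * C p ^ 2 * C a * (C q * X 1 + C r * X 2)) +
      X 1 ^ 2 * (3 * C p ^ 2 * X 0 ^ 2 * C q * C b + 6 * C p * C q * C r * C b * X 0 * X 2 +
        ternaryLinearForm a b c *
          (3 * C p * X 0 * C q ^ 2 + C q ^ 3 * X 1 + 3 * C q ^ 2 * C r * X 2)) +
      X 2 ^ 2 * (3 * C p ^ 2 * X 0 ^ 2 * C r * C c + 6 * C p * C q * C r * C c * X 0 * X 1 +
        ternaryLinearForm a b c *
          (3 * C p * X 0 * C r ^ 2 + 3 * C q * C r ^ 2 * X 1 + C r ^ 3 * X 2)) := by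
    have hmon (t : ℂ) : monomial (Finsupp.single (0 : Fin 3) 2 + Finsupp.single (1 : Fin 3) 1 +
        Finsupp.single (2 : Fin 3) 1) t = C t * (X 0 ^ 2 * X 1 * X 2) := by
      rw [X_pow_eq_monomial]
      simp only [X, C_mul_monomial, monomial_mul, mul_one]
    rw [hmon]
    simp only [ternaryLinearForm, map_add, map_mul, map_pow, map_ofNat]
    ring
  rw [expand]
  simp only [coeff_add]
  rw [coeff_X_pow_mul_eq_zero (by simp), coeff_X_pow_mul_eq_zero (by simp),
    coeff_X_pow_mul_eq_zero (by simp), coeff_monomial, if_pos rfl]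
  ring

/-- The algebraic computation underlying the residue formula for the Futaki invariant
on the weighted projective plane `ℙ²_w`: clearing denominators in
`F(a₀,a₁,a₂) = ∑ᵢ (1/wᵢ²) (∑_{k≠i} (aₖwᵢ - aᵢwₖ))³ / ∏_{k≠i} (aₖwᵢ - aᵢwₖ)`
yields a homogeneous polynomial of degree 4 whose coefficient of `X₀²X₁X₂` is the
displayed expression. -/
theorem stmt0 (w₀ w₁ w₂ : ℝ) (hw₀ : w₀ ≠ 0) (hw₁ : w₁ ≠ 0) (hw₂ : w₂ ≠ 0) :
    ∃ P : MvPolynomial (Fin 3) ℂ,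
      P.IsHomogeneous 4 ∧
      (∀ a₀ a₁ a₂ : ℂ,
        a₀ * (w₁ : ℂ) ≠ a₁ * (w₀ : ℂ) →
        a₀ * (w₂ : ℂ) ≠ a₂ * (w₀ : ℂ) →
        a₁ * (w₂ : ℂ) ≠ a₂ * (w₁ : ℂ) →
        (w₀ : ℂ) ^ 2 * (w₁ : ℂ) ^ 2 * (w₂ : ℂ) ^ 2 *
          ((a₀ * w₁ - a₁ * w₀) * ((a₀ * w₂ - a₂ * w₀) * (a₁ * w₂ - a₂ * w₁))) *
          ((1 / (w₀ : ℂ) ^ 2) *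
              ((a₁ * w₀ - a₀ * w₁) + (a₂ * w₀ - a₀ * w₂)) ^ 3 /
              ((a₁ * w₀ - a₀ * w₁) * (a₂ * w₀ - a₀ * w₂)) +
            (1 / (w₁ : ℂ) ^ 2) *
              ((a₀ * w₁ - a₁ * w₀) + (a₂ * w₁ - a₁ * w₂)) ^ 3 /
              ((a₀ * w₁ - a₁ * w₀) * (a₂ * w₁ - a₁ * w₂)) +
            (1 / (w₂ : ℂ) ^ 2) *
              ((a₀ * w₂ - a₂ * w₀) + (a₁ * w₂ - a₂ * w₁)) ^ 3 /
              ((a₀ * w₂ - a₂ * w₀) * (a₁ * w₂ - a₂ * w₁))) =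
          MvPolynomial.eval ![a₀, a₁, a₂] P) ∧
      MvPolynomial.coeff
          (Finsupp.single (0 : Fin 3) 2 + Finsupp.single (1 : Fin 3) 1 +
            Finsupp.single (2 : Fin 3) 1) P =
        (-3 * w₀ * w₁ ^ 5 * w₂ ^ 2 - 3 * w₀ * w₁ ^ 4 * w₂ ^ 3 + 3 * w₀ * w₁ ^ 3 * w₂ ^ 4 +
            3 * w₀ * w₁ ^ 2 * w₂ ^ 5 - 3 * w₀ ^ 4 * w₁ ^ 2 * w₂ ^ 2 +
            3 * w₀ ^ 3 * w₁ ^ 2 * w₂ ^ 3 + 6 * w₀ ^ 2 * w₁ ^ 2 * w₂ ^ 4 +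
            3 * w₀ ^ 4 * w₁ ^ 2 * w₂ ^ 2 - 3 * w₀ ^ 3 * w₁ ^ 3 * w₂ ^ 2 -
            6 * w₀ ^ 2 * w₁ ^ 4 * w₂ ^ 2 : ℝ) := by
  have hc₀ : (w₀ : ℂ) ≠ 0 := Complex.ofReal_ne_zero.mpr hw₀
  have hc₁ : (w₁ : ℂ) ≠ 0 := Complex.ofReal_ne_zero.mpr hw₁
  have hc₂ : (w₂ : ℂ) ≠ 0 := Complex.ofReal_ne_zero.mpr hw₂
  refine ⟨MvPolynomial.C ((w₁ : ℂ) ^ 2 * w₂ ^ 2) * (ternaryLinearForm 0 w₂ (-w₁) *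
        ternaryLinearForm (-(w₁ + w₂)) w₀ w₀ ^ 3) +
      MvPolynomial.C (-((w₀ : ℂ) ^ 2 * w₂ ^ 2)) * (ternaryLinearForm w₂ 0 (-w₀) *
        ternaryLinearForm w₁ (-(w₀ + w₂)) w₁ ^ 3) +
      MvPolynomial.C ((w₀ : ℂ) ^ 2 * w₁ ^ 2) * (ternaryLinearForm w₁ (-w₀) 0 *
        ternaryLinearForm w₂ w₂ (-(w₀ + w₁)) ^ 3),
    ((isHomogeneous_C_mul_linear_mul_cube ..).add
      (isHomogeneous_C_mul_linear_mul_cube ..)).add (isHomogeneous_C_mul_linear_mul_cube ..),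
    ?_, ?_⟩
  · intro a₀ a₁ a₂ h₀₁ h₀₂ h₁₂
    simp only [map_add, map_mul, map_pow, MvPolynomial.eval_C, eval_ternaryLinearForm]
    have clear_denominators (u v s x y z A B E : ℂ) (hu : u ≠ 0) (hv : v ≠ 0) (hs : s ≠ 0)
        (hx : x ≠ 0) (hy : y ≠ 0) (hz : z ≠ 0) :
        u ^ 2 * v ^ 2 * s ^ 2 * (x * (y * z)) *
          (1 / u ^ 2 * A / (-x * -y) + 1 / v ^ 2 * B / (x * -z) + 1 / s ^ 2 * E / (y * z)) =
        v ^ 2 * s ^ 2 * z * A - u ^ 2 * s ^ 2 * y * B + u ^ 2 * v ^ 2 * x * E := by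
      field_simp
      ring
    have key := clear_denominators w₀ w₁ w₂ (a₀ * w₁ - a₁ * w₀) (a₀ * w₂ - a₂ * w₀)
      (a₁ * w₂ - a₂ * w₁) (((a₁ * w₀ - a₀ * w₁) + (a₂ * w₀ - a₀ * w₂)) ^ 3)
      (((a₀ * w₁ - a₁ * w₀) + (a₂ * w₁ - a₁ * w₂)) ^ 3)
      (((a₀ * w₂ - a₂ * w₀) + (a₁ * w₂ - a₂ * w₁)) ^ 3) hc₀ hc₁ hc₂
      (sub_ne_zero.mpr h₀₁) (sub_ne_zero.mpr h₀₂) (sub_ne_zero.mpr h₁₂)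
    simp only [neg_sub] at key
    rw [key]
    ring
  · simp only [MvPolynomial.coeff_add, MvPolynomial.coeff_C_mul, coeff_linear_mul_cube]
    push_cast
    ring
end

section
/- Let $w_0, w_1, w_2$ be positive integers with $1 \le w_0 \le w_2 < w_1$ (viewed as complex numbers via the natural coercion). Then there exist complex numbers $a_0, a_1, a_2$, all nonzero, with $a_i w_j \neq a_j w_i$ for all $0 \le i < j \le 2$, such that $\sum_{i=0}^{2} \frac{1}{w_i^2} \cdot \frac{\big(\sum_{k \neq i} (a_k w_i - a_i w_k)\big)^3}{\prod_{k \neq i} (a_k w_i - a_i w_k)} \neq 0$. Here, for each $i \in \{0,1,2\}$, the sums and products over $k \neq i$ range over the two indices in $\{0,1,2\} \setminus \{i\}$. -/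
/-- For weights `1 ≤ w₀ ≤ w₂ < w₁` there exist nonzero `a₀, a₁, a₂ ∈ ℂ` with
`aᵢwⱼ ≠ aⱼwᵢ` for all `i < j` such that the residue-formula sum
`∑ᵢ (1/wᵢ²) (∑_{k≠i} (aₖwᵢ - aᵢwₖ))³ / ∏_{k≠i} (aₖwᵢ - aᵢwₖ)` is nonzero;
hence the Futaki character of `ℙ²_w` does not vanish identically. -/
theorem stmt2 (w₀ w₁ w₂ : ℕ) (h₀ : 1 ≤ w₀) (h₀₂ : w₀ ≤ w₂) (h₂₁ : w₂ < w₁) :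
    ∃ a₀ a₁ a₂ : ℂ,
      a₀ ≠ 0 ∧ a₁ ≠ 0 ∧ a₂ ≠ 0 ∧
      a₀ * (w₁ : ℂ) ≠ a₁ * (w₀ : ℂ) ∧
      a₀ * (w₂ : ℂ) ≠ a₂ * (w₀ : ℂ) ∧
      a₁ * (w₂ : ℂ) ≠ a₂ * (w₁ : ℂ) ∧
      (1 / (w₀ : ℂ) ^ 2) *
          ((a₁ * w₀ - a₀ * w₁) + (a₂ * w₀ - a₀ * w₂)) ^ 3 /
          ((a₁ * w₀ - a₀ * w₁) * (a₂ * w₀ - a₀ * w₂)) +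
        (1 / (w₁ : ℂ) ^ 2) *
          ((a₀ * w₁ - a₁ * w₀) + (a₂ * w₁ - a₁ * w₂)) ^ 3 /
          ((a₀ * w₁ - a₁ * w₀) * (a₂ * w₁ - a₁ * w₂)) +
        (1 / (w₂ : ℂ) ^ 2) *
          ((a₀ * w₂ - a₂ * w₀) + (a₁ * w₂ - a₂ * w₁)) ^ 3 /
          ((a₀ * w₂ - a₂ * w₀) * (a₁ * w₂ - a₂ * w₁)) ≠ 0 := by
  have hw₀ : (w₀ : ℂ) ≠ 0 := by exact_mod_cast (by omega : w₀ ≠ 0)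
  have hw₁ : (w₁ : ℂ) ≠ 0 := by exact_mod_cast (by omega : w₁ ≠ 0)
  have hw₂ : (w₂ : ℂ) ≠ 0 := by exact_mod_cast (by omega : w₂ ≠ 0)
  have hW : (w₀ + w₁ + w₂ : ℂ) ≠ 0 := by exact_mod_cast (by omega : w₀ + w₁ + w₂ ≠ 0)
  have hd : (w₁ - w₀ : ℂ) ≠ 0 := sub_ne_zero.2 (by exact_mod_cast (by omega : w₁ ≠ w₀))
  generalize (w₀ : ℂ) = x at *
  generalize (w₁ : ℂ) = y at *
  generalize (w₂ : ℂ) = z at *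
  refine ⟨x, 3 * y, 2 * z, hw₀, by simpa, by simpa, ?_, ?_, ?_, ?_⟩
  · intro h
    have : 2 * (x * y) = 0 := by linear_combination -h
    simp_all
  · intro h
    have : x * z = 0 := by linear_combination -h
    simp_all
  · intro h
    have : y * z = 0 := by linear_combination h
    simp_all
  · have key : (x + y + z) ^ 2 * (3 * (y - x)) / (x * y * z) ≠ 0 := by
      simp [hw₀, hw₁, hw₂, hW, hd]
    convert key using 1
    rw [show 3 * y * x - x * y = 2 * (x * y) by ring,
      show 2 * z * x - x * z = x * z by ring,
      show x * y - 3 * y * x = -(2 * (x * y)) by ring,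
      show 2 * z * y - 3 * y * z = -(y * z) by ring,
      show x * z - 2 * z * x = -(x * z) by ring,
      show 3 * y * z - 2 * z * y = y * z by ring]
    field_simp
    ring
end

section
/- Let $U \subseteq \mathbb{C}^n$ be an open set and let $\xi = (\xi_1, \dots, \xi_n) : U \to \mathbb{C}^n$ be holomorphic with $\xi(z) \neq 0$ for all $z \in U$. For each $j$ define $g_j : U \to \mathbb{C}$ by $g_j(z) = \overline{\xi_j(z)} / \sum_{i=1}^{n} \xi_i(z) \overline{\xi_i(z)}$ (a smooth function on $U$). Then for every $z \in U$, the $\mathbb{R}$-linear map $\sum_{j=1}^{n} \xi_j(z) \cdot D g_j(z) : \mathbb{C}^n \to \mathbb{C}$, where $D g_j(z)$ denotes the real Fr\'echet derivative of $g_j$ at $z$, is complex linear. -/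
open scoped ComplexOrder in
/-- The squared length `∑ᵢ wᵢ conj wᵢ` of a nonzero complex vector is nonzero. -/
theorem sum_mul_conj_ne_zero {ι : Type*} [Fintype ι] {w : ι → ℂ} (hw : w ≠ 0) :
    ∑ i, w i * starRingEnd ℂ (w i) ≠ 0 :=
  fun h => hw (dotProduct_self_star_eq_zero.mp h)

/-- If `∑ⱼ fⱼ gⱼ` is locally constant near `z`, then the Leibniz rule gives
`∑ⱼ fⱼ(z) D gⱼ(z) = -∑ⱼ gⱼ(z) D fⱼ(z)`. -/
theorem sum_mul_fderiv_eq_neg_of_sum_mul_eventuallyEq_const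
    {ι E : Type*} [Fintype ι] [NormedAddCommGroup E] [NormedSpace ℝ E]
    {f g : ι → E → ℂ} {f' : ι → E →L[ℝ] ℂ} {z : E} {c : ℂ}
    (hf : ∀ j, HasFDerivAt (f j) (f' j) z) (hg : ∀ j, DifferentiableAt ℝ (g j) z)
    (h : (fun w => ∑ j, f j w * g j w) =ᶠ[nhds z] fun _ => c) (v : E) :
    ∑ j, f j z * fderiv ℝ (g j) z v = -∑ j, g j z * f' j v := by
  have hsum := HasFDerivAt.fun_sum (u := Finset.univ)
    fun j _ => (hf j).mul (hg j).hasFDerivAt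
  have hzero := hsum.unique ((hasFDerivAt_const c z).congr_of_eventuallyEq h)
  have hv := congrArg (fun L : E →L[ℝ] ℂ => L v) hzero
  exact eq_neg_of_add_eq_zero_left (by simpa [Finset.sum_add_distrib] using hv)

/-- The transgression identity `i(ξ) ∂̄ω = 0`: if `ξ : U → ℂⁿ` is holomorphic and
nonvanishing on the open set `U`, and `gⱼ = conj ξⱼ / ∑ᵢ ξᵢ conj ξᵢ`, then at every
point `z ∈ U` the real-linear map `v ↦ ∑ⱼ ξⱼ(z) · (D gⱼ)(z)(v)` (built from the real
Fréchet derivatives of the `gⱼ`) is complex linear. -/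
theorem stmt3 (n : ℕ) (U : Set (Fin n → ℂ)) (hU : IsOpen U)
    (ξ : (Fin n → ℂ) → Fin n → ℂ) (hξ : DifferentiableOn ℂ ξ U)
    (hξ0 : ∀ z ∈ U, ξ z ≠ 0)
    (g : Fin n → (Fin n → ℂ) → ℂ)
    (hg : ∀ j z, g j z =
      starRingEnd ℂ (ξ z j) / (∑ i, ξ z i * starRingEnd ℂ (ξ z i))) :
    ∀ z ∈ U, IsLinearMap ℂ (fun v : Fin n → ℂ => ∑ j, ξ z j * fderiv ℝ (g j) z v) := by
  intro z hz
  have hξz : DifferentiableAt ℂ ξ z := hξ.differentiableAt (hU.mem_nhds hz)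
  have hd (j : Fin n) : HasFDerivAt (fun w => ξ w j)
      ((fderiv ℂ (fun w => ξ w j) z).restrictScalars ℝ) z :=
    (differentiableAt_pi.1 hξz j).hasFDerivAt.restrictScalars ℝ
  have hconj (j : Fin n) : DifferentiableAt ℝ (fun w => starRingEnd ℂ (ξ w j)) z :=
    (hd j).differentiableAt.star
  have hgd (j : Fin n) : DifferentiableAt ℝ (g j) z := by
    simp only [funext (hg j), div_eq_mul_inv]
    have hnorm : DifferentiableAt ℝ
        (fun w => ∑ i, ξ w i * starRingEnd ℂ (ξ w i)) z :=
      DifferentiableAt.fun_sum fun i _ => (hd i).differentiableAt.fun_mul (hconj i)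
    exact (hconj j).fun_mul (hnorm.fun_inv (sum_mul_conj_ne_zero (hξ0 z hz)))
  have hone : (fun w => ∑ j, ξ w j * g j w) =ᶠ[nhds z] fun _ => 1 := by
    filter_upwards [hU.mem_nhds hz] with w hw
    simp only [hg, ← mul_div_assoc, ← Finset.sum_div]
    exact div_self (sum_mul_conj_ne_zero (hξ0 w hw))
  have key : (fun v => ∑ j, ξ z j * fderiv ℝ (g j) z v) =
      ⇑(-∑ j, g j z • fderiv ℂ (fun w => ξ w j) z) := by
    ext v
    simpa using
      sum_mul_fderiv_eq_neg_of_sum_mul_eventuallyEq_const hd hgd hone v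
  rw [key]
  exact (-∑ j, g j z • fderiv ℂ (fun w => ξ w j) z).toLinearMap.isLinear
end
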